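/- (Existence of ideal knots.) Let n ≥ 2 and let γ₁ be a C^{1,1} knot in ℝⁿ. Then there exists a C^{1,1} knot γ₀ in the knot class of γ₁ with R_O(K₀) > 0 (where K₀ is the image of γ₀) such that for every C^{1,1} knot γ in the knot class of γ₁ with image K: ℓ(γ₀)·R_O(K) ≤ ℓ(γ)·R_O(K₀), i.e. 0 < ℓ_e(γ₀) ≤ ℓ_e(γ). In particular, if ℓ(γ₀) = ℓ(γ) then R_O(K₀) ≥ R_O(K). -/

import Mathlib

open Set Filter MeasureTheory
open scoped RealInnerProductSpace Topology ENNReal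

noncomputable section

/-- Euclidean space `ℝⁿ`. -/
abbrev Euc (n : ℕ) := EuclideanSpace ℝ (Fin n)

/-- Generalized curvature `κγ(s)` of a curve with derivative `γd` and parameter domain `D`:
the limsup, as `x, y → s` with `x ≠ y`, of `∠(γd x, γd y) / |x - y|`, expressed as the
infimum of all eventual bounds. -/
def curvAt {n : ℕ} (γd : ℝ → Euc n) (D : Set ℝ) (s : ℝ) : ℝ :=
  sInf {Λ : ℝ | 0 ≤ Λ ∧ ∃ δ > 0, ∀ x ∈ D, ∀ y ∈ D, x ≠ y →
    |x - s| < δ → |y - s| < δ →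
    InnerProductGeometry.angle (γd x) (γd y) ≤ Λ * |x - y|}

/-- `κγ(s) < Λ`: there are `δ > 0` and `Λ' < Λ` bounding the angle dilation near `s`. -/
def CurvLt {n : ℕ} (γd : ℝ → Euc n) (D : Set ℝ) (s Λ : ℝ) : Prop :=
  ∃ δ > 0, ∃ Λ' < Λ, ∀ x ∈ D, ∀ y ∈ D, x ≠ y → |x - s| < δ → |y - s| < δ →
    InnerProductGeometry.angle (γd x) (γd y) ≤ Λ' * |x - y|

/-- `f` restricted to `[a, c]` is a planar circular arc of radius `1/Λ`
of length in `[0, 2π/Λ)`. -/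
def IsArc {n : ℕ} (Λ : ℝ) (f : ℝ → Euc n) (a c : ℝ) : Prop :=
  c - a < 2 * Real.pi / Λ ∧
  ∃ (o u e : Euc n) (s₁ : ℝ), ‖u‖ = 1 ∧ ‖e‖ = 1 ∧ ⟪u, e⟫ = 0 ∧
    ∀ s ∈ Icc a c,
      f s = o + (Λ⁻¹ * Real.cos (Λ * (s - s₁))) • u + (Λ⁻¹ * Real.sin (Λ * (s - s₁))) • e

/-- `f` restricted to `[a, c]` is a planar circular arc of radius `r`. -/
def IsArcR {n : ℕ} (r : ℝ) (f : ℝ → Euc n) (a c : ℝ) : Prop :=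
  ∃ (o u e : Euc n) (s₁ : ℝ), ‖u‖ = 1 ∧ ‖e‖ = 1 ∧ ⟪u, e⟫ = 0 ∧
    ∀ s ∈ Icc a c,
      f s = o + (r * Real.cos ((s - s₁) / r)) • u + (r * Real.sin ((s - s₁) / r)) • e

/-- `O_p(v, r)`: the union of the open balls of radius `r` tangent to `v^⊥` at `p`. -/
def Odisk {n : ℕ} (p v : Euc n) (r : ℝ) : Set (Euc n) :=
  {x | ∃ w : Euc n, ‖w‖ = 1 ∧ ⟪w, v⟫ = 0 ∧ ‖x - p - r • w‖ < r}

/-- Ball radius `R_O` of the curve `f` (with derivative/tangent field `γd`) on domain `D`. -/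
def RO {n : ℕ} (f γd : ℝ → Euc n) (D : Set ℝ) : ℝ :=
  sInf {r : ℝ | 0 < r ∧ ∃ s ∈ D, ∃ t ∈ D, ∃ w : Euc n,
    ‖w‖ = 1 ∧ ⟪w, γd s⟫ = 0 ∧ ‖f t - f s - r • w‖ < r}

/-- Minimal double critical distance of the curve `f` with tangent field `γd`. -/
def MDC {n : ℕ} (f γd : ℝ → Euc n) : ℝ :=
  sInf {d : ℝ | ∃ x y : ℝ, f x ≠ f y ∧ ⟪f x - f y, γd x⟫ = 0 ∧
    ⟪f x - f y, γd y⟫ = 0 ∧ d = ‖f x - f y‖}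

/-- Normal injectivity radius `i(K, ℝⁿ)` of the curve `f` with tangent field `γd`. -/
def injRad {n : ℕ} (f γd : ℝ → Euc n) : ℝ :=
  sSup ({0} ∪ {r : ℝ | 0 < r ∧ ∀ s t : ℝ, ∀ u w : Euc n,
    ⟪u, γd s⟫ = 0 → ⟪w, γd t⟫ = 0 → ‖u‖ < r → ‖w‖ < r →
    f s + u = f t + w → f s = f t ∧ u = w})

/-- A knot: a simple closed unit-speed `C^{1,1}` curve, as an `L`-periodic map `ℝ → ℝⁿ`,
injective on `[0, L)`, with `‖γ'‖ ≡ 1` and `γ'` Lipschitz. -/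
structure Knot (n : ℕ) where
  L : ℝ
  Lpos : 0 < L
  f : ℝ → Euc n
  fd : ℝ → Euc n
  per : ∀ s, f (s + L) = f s
  perd : ∀ s, fd (s + L) = fd s
  deriv : ∀ s, HasDerivAt f (fd s) s
  unit : ∀ s, ‖fd s‖ = 1
  lipd : ∃ C : NNReal, LipschitzWith C fd
  inj : InjOn f (Ico 0 L)

/-- Ropelength `ℓ_e(γ) = L / R_O(K)`. -/
def Knot.ropelength {n : ℕ} (k : Knot n) : ℝ := k.L / RO k.f k.fd univ

/-- The set `I_c` of parameters realizing the minimal double critical distance. -/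
def Knot.Ic {n : ℕ} (k : Knot n) : Set ℝ :=
  {x | ∃ y : ℝ, k.f x ≠ k.f y ∧ ⟪k.f x - k.f y, k.fd x⟫ = 0 ∧
    ⟪k.f x - k.f y, k.fd y⟫ = 0 ∧ ‖k.f x - k.f y‖ = MDC k.f k.fd}

/-- `sup_s κγ(s)` for a knot. -/
def Knot.supCurv {n : ℕ} (k : Knot n) : ℝ := ⨆ s : ℝ, curvAt k.fd univ s

/-- Analytic focal distance `F_k(γ) = (sup_s κγ(s))⁻¹`. -/
def Knot.Fk {n : ℕ} (k : Knot n) : ℝ := (k.supCurv)⁻¹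

/-- Two knots are in the same knot class: after rescaling their domains to `ℝ/ℤ`
(realized by `1`-periodic maps `ℝ → ℝⁿ`), they are joined by a continuous homotopy
through injective loops. -/
def SameKnotClass {n : ℕ} (k₁ k₂ : Knot n) : Prop :=
  ∃ H : ℝ → ℝ → Euc n,
    ContinuousOn (fun z : ℝ × ℝ => H z.1 z.2) (Icc 0 1 ×ˢ univ) ∧
    (∀ t s, H t (s + 1) = H t s) ∧
    (∀ s, H 0 s = k₁.f (k₁.L * s)) ∧
    (∀ s, H 1 s = k₂.f (k₂.L * s)) ∧
    ∀ t ∈ Icc (0 : ℝ) 1, InjOn (H t) (Ico 0 1)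

/-- A knot is relatively extremal: a relative minimum of ropelength within its knot class
with respect to the `C¹` topology (on rescaled parametrizations). -/
def RelativelyExtremal {n : ℕ} (k : Knot n) : Prop :=
  ∃ ε > 0, ∀ η : Knot n, SameKnotClass k η →
    (∀ s : ℝ, ‖η.f (η.L * s) - k.f (k.L * s)‖ +
      ‖η.L • η.fd (η.L * s) - k.L • k.fd (k.L * s)‖ < ε) →
    k.ropelength ≤ η.ropelength

/-- The class `C(p, q; v, w; Λ)`: unit-speed `C^{1,1}` curves `γ : [0, L] → ℝⁿ`
(`L` not fixed) from `p` to `q` with initial/terminal directions `v, w`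
and `Λ`-Lipschitz derivative (curvature at most `Λ`). -/
structure CurveCC (n : ℕ) (p q v w : Euc n) (Λ : ℝ) where
  L : ℝ
  Lnn : 0 ≤ L
  f : ℝ → Euc n
  fd : ℝ → Euc n
  deriv : ∀ s ∈ Icc (0 : ℝ) L, HasDerivWithinAt f (fd s) (Icc 0 L) s
  unit : ∀ s ∈ Icc (0 : ℝ) L, ‖fd s‖ = 1
  lip : LipschitzOnWith Λ.toNNReal fd (Icc 0 L)
  i0 : f 0 = p
  id0 : fd 0 = v
  iL : f L = q
  idL : fd L = w

/-- A `C¹` closed curve of period `L` with nowhere-vanishing derivative. -/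
structure ClosedC1 (n : ℕ) (L : ℝ) where
  f : ℝ → Euc n
  fd : ℝ → Euc n
  per : ∀ s, f (s + L) = f s
  perd : ∀ s, fd (s + L) = fd s
  deriv : ∀ s, HasDerivAt f (fd s) s
  nz : ∀ s, fd s ≠ 0

/-- A simple closed `C^{1,1}` curve of period `L` with nowhere-vanishing derivative. -/
structure ClosedC11 (n : ℕ) (L : ℝ) extends ClosedC1 n L where
  lipd : ∃ C : NNReal, LipschitzWith C fd
  inj : InjOn f (Ico 0 L)

/-- The unit tangent field of `c` is `C`-Lipschitz with respect to the arclength of `c`. -/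
def TangentLip {n : ℕ} {L : ℝ} (c : ClosedC1 n L) (C : ℝ) : Prop :=
  ∀ x y : ℝ, x ≤ y →
    ‖‖c.fd y‖⁻¹ • c.fd y - ‖c.fd x‖⁻¹ • c.fd x‖ ≤ C * ∫ t in x..y, ‖c.fd t‖

/-- Pointwise geometric focal distance `F_g(γ(s))` of the curve `f` with domain `D`. -/
def FgPt {n : ℕ} (f fd : ℝ → Euc n) (D : Set ℝ) (s : ℝ) : ℝ :=
  sInf {r : ℝ | 0 < r ∧ f s ∈ closure (Odisk (f s) (fd s) r ∩ (f '' D))}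

end

/-- The curve `f` with unit tangent field `fd` stays outside all open balls of radius `ρ` tangent to
it, expressed through the normal parts of its chords. -/
def IsThick {n : ℕ} (ρ : ℝ) (f fd : ℝ → Euc n) : Prop :=
  ∀ s t, 2 * ρ * ‖f t - f s - ⟪f t - f s, fd s⟫ • fd s‖ ≤ ‖f t - f s‖ ^ 2

section Curves

variable {n : ℕ} {f fd : ℝ → Euc n} {M ρ : ℝ}

theorem norm_taylor_le (hd : ∀ s, HasDerivAt f (fd s) s)
    (hM : ∀ s t, ‖fd t - fd s‖ ≤ M * |t - s|) (s t : ℝ) :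
    ‖f t - f s - (t - s) • fd s‖ ≤ M * |t - s| ^ 2 := by
  have hM0 : 0 ≤ M := by
    have := (norm_nonneg _).trans (hM 0 1)
    simpa using this
  have key := (convex_uIcc s t).norm_image_sub_le_of_norm_hasDerivWithin_le
    (f := fun u => f u - u • fd s) (f' := fun u => fd u - fd s) (C := M * |t - s|)
    (fun u _ => by
      have := (hd u).sub ((hasDerivAt_id u).smul_const (fd s))
      simp only [one_smul] at this
      exact this.hasDerivWithinAt)
    (fun u hu => (hM s u).trans
      (mul_le_mul_of_nonneg_left (abs_sub_left_of_mem_uIcc hu) hM0))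
    left_mem_uIcc right_mem_uIcc
  rw [Real.norm_eq_abs] at key
  calc ‖f t - f s - (t - s) • fd s‖ = ‖f t - t • fd s - (f s - s • fd s)‖ := by
        congr 1; rw [sub_smul]; abel
    _ ≤ M * |t - s| * |t - s| := key
    _ = M * |t - s| ^ 2 := by ring

theorem hasDerivAt_of_norm_taylor_le
    (h : ∀ s t, ‖f t - f s - (t - s) • fd s‖ ≤ M * |t - s| ^ 2) (s : ℝ) :
    HasDerivAt f (fd s) s := by
  rw [hasDerivAt_iff_isLittleO]
  have h1 : (fun t => f t - f s - (t - s) • fd s) =O[𝓝 s] fun t => (t - s) ^ 2 :=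
    Asymptotics.IsBigO.of_bound M (Eventually.of_forall fun t => by
      simpa using h s t)
  refine h1.trans_isLittleO ?_
  have := (Asymptotics.isLittleO_pow_id (𝕜 := ℝ) one_lt_two).comp_tendsto
    (k := fun t : ℝ => t - s) (l' := 𝓝 s) (by
      have : Continuous fun t : ℝ => t - s := by fun_prop
      simpa using this.tendsto s)
  exact this

/-- A quadratic error term in a Lipschitz bound can be removed by subdivision. -/
theorem norm_sub_le_of_quadratic {g : ℝ → Euc n} {A K : ℝ}
    (h : ∀ s t, ‖g t - g s‖ ≤ A * |t - s| + K * |t - s| ^ 2) (s t : ℝ) :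
    ‖g t - g s‖ ≤ A * |t - s| := by
  have hN : ∀ N : ℕ, ‖g t - g s‖ ≤ A * |t - s| + K * |t - s| ^ 2 * (1 / ((N : ℝ) + 1)) := by
    intro N
    have hN0 : (0 : ℝ) < (N : ℝ) + 1 := by positivity
    set e := (t - s) / (N + 1) with he
    have hp : ∀ m : ℕ, ‖g (s + m * e) - g s‖ ≤ m * (A * |e| + K * |e| ^ 2) := by
      intro m
      induction m with
      | zero => simp
      | succ m ih =>
        have h1 := h (s + m * e) (s + (m + 1 : ℕ) * e)
        have h2 : s + (m + 1 : ℕ) * e - (s + m * e) = e := by push_cast; ring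
        rw [h2] at h1
        have h3 := norm_sub_le_norm_sub_add_norm_sub (g (s + (m + 1 : ℕ) * e)) (g (s + m * e)) (g s)
        push_cast at *
        linarith
    have h1 := hp (N + 1)
    have h2 : s + ((N + 1 : ℕ) : ℝ) * e = t := by
      rw [he]; push_cast; field_simp; ring
    have h3 : |e| = |t - s| / (N + 1) := by rw [he, abs_div, abs_of_pos hN0]
    rw [h2, h3] at h1
    refine h1.trans (le_of_eq ?_)
    push_cast
    field_simp
  have hl : Tendsto (fun N : ℕ => A * |t - s| + K * |t - s| ^ 2 * (1 / ((N : ℝ) + 1))) atTop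
      (𝓝 (A * |t - s| + K * |t - s| ^ 2 * 0)) :=
    (tendsto_one_div_add_atTop_nhds_zero_nat.const_mul _).const_add _
  simpa using ge_of_tendsto' hl hN

theorem one_sub_inner_eq {v w : Euc n} (hv : ‖v‖ = 1) (hw : ‖w‖ = 1) :
    1 - ⟪v, w⟫ = ‖v - w‖ ^ 2 / 2 := by
  rw [norm_sub_sq_real, hv, hw]; ring

theorem abs_sub_inner_le (hd : ∀ s, HasDerivAt f (fd s) s) (hu : ∀ s, ‖fd s‖ = 1)
    (hM : ∀ s t, ‖fd t - fd s‖ ≤ M * |t - s|) (s t : ℝ) :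
    |(t - s) - ⟪f t - f s, fd s⟫| ≤ M ^ 2 * |t - s| ^ 3 := by
  have key := (convex_uIcc s t).norm_image_sub_le_of_norm_hasDerivWithin_le
    (f := fun u => u - ⟪f u, fd s⟫) (f' := fun u => 1 - ⟪fd u, fd s⟫) (C := M ^ 2 * |t - s| ^ 2)
    (fun u _ => by
      have := (hasDerivAt_id u).sub ((hd u).inner ℝ (hasDerivAt_const u (fd s)))
      simp only [inner_zero_right, zero_add] at this
      exact this.hasDerivWithinAt)
    (fun u hu' => by
      rw [one_sub_inner_eq (hu u) (hu s), Real.norm_eq_abs, abs_of_nonneg (by positivity)]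
      have h1 : ‖fd u - fd s‖ ^ 2 ≤ (M * |u - s|) ^ 2 :=
        pow_le_pow_left₀ (norm_nonneg _) (hM s u) 2
      have h2 : |u - s| ^ 2 ≤ |t - s| ^ 2 :=
        pow_le_pow_left₀ (abs_nonneg _) (abs_sub_left_of_mem_uIcc hu') 2
      have h3 : M ^ 2 * |u - s| ^ 2 ≤ M ^ 2 * |t - s| ^ 2 :=
        mul_le_mul_of_nonneg_left h2 (sq_nonneg _)
      have h4 := sq_nonneg ‖fd u - fd s‖
      rw [mul_pow] at h1
      linarith)
    left_mem_uIcc right_mem_uIcc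
  rw [Real.norm_eq_abs, Real.norm_eq_abs] at key
  calc |(t - s) - ⟪f t - f s, fd s⟫| = |t - ⟪f t, fd s⟫ - (s - ⟪f s, fd s⟫)| := by
        congr 1; rw [inner_sub_left]; ring
    _ ≤ M ^ 2 * |t - s| ^ 2 * |t - s| := key
    _ = M ^ 2 * |t - s| ^ 3 := by ring

theorem norm_sub_le_abs_sub (hd : ∀ s, HasDerivAt f (fd s) s) (hu : ∀ s, ‖fd s‖ = 1) (s t : ℝ) :
    ‖f t - f s‖ ≤ |t - s| := by
  have key := convex_univ.norm_image_sub_le_of_norm_hasDerivWithin_le (C := 1)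
    (fun u _ => (hd u).hasDerivWithinAt) (fun u _ => (hu u).le) (mem_univ s) (mem_univ t)
  simpa using key

/-- A thick unit-speed curve has curvature at most the inverse of its thickness. -/
theorem IsThick.norm_tangent_sub_le (h : IsThick ρ f fd) (hρ : 0 < ρ)
    (hd : ∀ s, HasDerivAt f (fd s) s) (hu : ∀ s, ‖fd s‖ = 1)
    (hM : ∀ s t, ‖fd t - fd s‖ ≤ M * |t - s|) (s t : ℝ) :
    ‖fd t - fd s‖ ≤ ρ⁻¹ * |t - s| := by
  refine norm_sub_le_of_quadratic (K := 2 * M ^ 2) (fun s t => ?_) s t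
  rcases eq_or_ne s t with rfl | hst
  · simp
  have hpos : 0 < |t - s| := abs_pos.2 (sub_ne_zero.2 hst.symm)
  have normal : ∀ a b : ℝ,
      ‖f b - f a - ⟪f b - f a, fd a⟫ • fd a‖ ≤ ρ⁻¹ / 2 * |b - a| ^ 2 := by
    intro a b
    have h1 := h a b
    have h2 : ‖f b - f a‖ ^ 2 ≤ |b - a| ^ 2 :=
      pow_le_pow_left₀ (norm_nonneg _) (norm_sub_le_abs_sub hd hu a b) 2
    have h3 := h1.trans h2
    have h4 : ρ⁻¹ / 2 * |b - a| ^ 2 = |b - a| ^ 2 / (2 * ρ) := by field_simp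
    rw [h4, le_div_iff₀ (by positivity)]
    linarith
  have n1 := normal s t
  have n2 := normal t s
  have e1 := abs_sub_inner_le hd hu hM s t
  have e2 := abs_sub_inner_le hd hu hM t s
  rw [abs_sub_comm s t] at n2
  rw [abs_sub_comm s t] at e2
  have id1 : (t - s) • (fd t - fd s) =
      (f t - f s - ⟪f t - f s, fd s⟫ • fd s) + (f s - f t - ⟪f s - f t, fd t⟫ • fd t)
      - ((t - s) - ⟪f t - f s, fd s⟫) • fd s - ((s - t) - ⟪f s - f t, fd t⟫) • fd t := by
    module
  have hn : |t - s| * ‖fd t - fd s‖ ≤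
      ρ⁻¹ / 2 * |t - s| ^ 2 + ρ⁻¹ / 2 * |t - s| ^ 2 + M ^ 2 * |t - s| ^ 3 +
        M ^ 2 * |t - s| ^ 3 := by
    rw [← Real.norm_eq_abs (t - s), ← norm_smul, id1, Real.norm_eq_abs]
    refine (norm_sub_le _ _).trans (add_le_add ((norm_sub_le _ _).trans
      (add_le_add ((norm_add_le _ _).trans (add_le_add n1 n2)) ?_)) ?_)
    · rwa [norm_smul, hu, mul_one]
    · rwa [norm_smul, hu, mul_one]
  refine le_of_mul_le_mul_left (hn.trans (le_of_eq ?_)) hpos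
  ring

theorem inner_le_norm_normalPart {d v w : Euc n} (hw : ‖w‖ = 1) (hwv : ⟪w, v⟫ = 0) :
    ⟪d, w⟫ ≤ ‖d - ⟪d, v⟫ • v‖ := by
  have h1 : ⟪d, w⟫ = ⟪d - ⟪d, v⟫ • v, w⟫ := by
    rw [inner_sub_left, inner_smul_left, real_inner_comm w v, hwv]; simp
  rw [h1]
  simpa [hw] using real_inner_le_norm (d - ⟪d, v⟫ • v) w

theorem exists_unit_inner_eq_norm_normalPart {d v : Euc n} (hv : ‖v‖ = 1)
    (hd : d - ⟪d, v⟫ • v ≠ 0) :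
    ∃ w : Euc n, ‖w‖ = 1 ∧ ⟪w, v⟫ = 0 ∧ ⟪d, w⟫ = ‖d - ⟪d, v⟫ • v‖ := by
  set p := d - ⟪d, v⟫ • v with hp
  have hpv : ⟪p, v⟫ = 0 := by
    rw [hp, inner_sub_left, inner_smul_left, real_inner_self_eq_norm_sq, hv]; simp
  have hpn : ‖p‖ ≠ 0 := norm_ne_zero_iff.2 hd
  refine ⟨‖p‖⁻¹ • p, by rw [norm_smul, norm_inv, norm_norm, inv_mul_cancel₀ hpn], by
    rw [inner_smul_left, hpv, mul_zero], ?_⟩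
  have : d = p + ⟪d, v⟫ • v := by rw [hp]; abel
  have h2 : ⟪d, p⟫ = ‖p‖ ^ 2 := by
    nth_rewrite 1 [this]
    rw [inner_add_left, inner_smul_left, real_inner_self_eq_norm_sq, real_inner_comm p v, hpv]
    simp
  rw [inner_smul_right, h2]
  field_simp

theorem norm_sub_smul_lt_iff {d w : Euc n} {r : ℝ} (hr : 0 < r) (hw : ‖w‖ = 1) :
    ‖d - r • w‖ < r ↔ ‖d‖ ^ 2 < 2 * r * ⟪d, w⟫ := by
  rw [← sq_lt_sq₀ (norm_nonneg _) hr.le, norm_sub_sq_real, norm_smul, hw, inner_smul_right]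
  simp only [Real.norm_eq_abs, mul_one, sq_abs]
  constructor <;> intro h <;> linarith

theorem isThick_RO (hu : ∀ s, ‖fd s‖ = 1) : IsThick (RO f fd univ) f fd := by
  intro s t
  by_contra! hlt
  set d := f t - f s
  set p := d - ⟪d, fd s⟫ • fd s
  have hp : 0 < ‖p‖ := by
    refine (norm_nonneg _).lt_of_ne' fun h0 => ?_
    rw [h0, mul_zero] at hlt
    exact absurd hlt (not_lt.2 (sq_nonneg _))
  have hR : ‖d‖ ^ 2 / (2 * ‖p‖) < RO f fd univ := by
    rw [div_lt_iff₀ (by positivity)]; linarith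
  obtain ⟨r, hr1, hr2⟩ := exists_between hR
  have hr0 : 0 < r := lt_of_le_of_lt (by positivity) hr1
  obtain ⟨w, hw, hwv, hdw⟩ := exists_unit_inner_eq_norm_normalPart (hu s) (norm_pos_iff.1 hp)
  refine absurd hr2 (not_lt.2 (csInf_le ⟨0, fun x hx => hx.1.le⟩
    ⟨hr0, s, mem_univ _, t, mem_univ _, w, hw, hwv, (norm_sub_smul_lt_iff hr0 hw).2 ?_⟩))
  rw [hdw]
  rw [div_lt_iff₀ (by positivity)] at hr1
  linarith

theorem norm_normalPart_le {v : Euc n} (hv : ‖v‖ = 1) (d : Euc n) (c : ℝ) :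
    ‖d - ⟪d, v⟫ • v‖ ≤ ‖d - c • v‖ := by
  refine le_of_sq_le_sq ?_ (norm_nonneg _)
  simp only [norm_sub_sq_real, norm_smul, hv, inner_smul_right, mul_one, Real.norm_eq_abs, sq_abs]
  nlinarith [sq_nonneg (c - ⟪d, v⟫)]

theorem half_abs_sub_le_norm_sub (hd : ∀ s, HasDerivAt f (fd s) s) (hu : ∀ s, ‖fd s‖ = 1)
    (hM : ∀ s t, ‖fd t - fd s‖ ≤ M * |t - s|) {s t : ℝ} (hst : M * |t - s| ≤ 1 / 2) :
    |t - s| / 2 ≤ ‖f t - f s‖ := by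
  have h1 := norm_taylor_le hd hM s t
  have h2 : ‖(t - s) • fd s‖ = |t - s| := by rw [norm_smul, hu, mul_one, Real.norm_eq_abs]
  have h3 := norm_sub_norm_le ((t - s) • fd s) (f t - f s)
  rw [h2, norm_sub_rev ((t - s) • fd s)] at h3
  nlinarith [abs_nonneg (t - s)]

end Curves

namespace Knot

variable {n : ℕ} (k : Knot n) {ρ : ℝ}

theorem continuous_f : Continuous k.f :=
  continuous_iff_continuousAt.2 fun s => (k.deriv s).continuousAt

theorem exists_lipschitz : ∃ M > 0, ∀ s t, ‖k.fd t - k.fd s‖ ≤ M * |t - s| := by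
  obtain ⟨C, hC⟩ := k.lipd
  refine ⟨C + 1, by positivity, fun s t => ?_⟩
  have := hC.norm_sub_le t s
  rw [Real.norm_eq_abs] at this
  nlinarith [abs_nonneg (t - s)]

theorem f_add_ne {s h : ℝ} (h0 : 0 < h) (hL : h < k.L) : k.f (s + h) ≠ k.f s := by
  intro heq
  have hp : Function.Periodic (fun x => (k.f x, k.f (x + h))) k.L := fun x => by
    simp only [k.per, add_right_comm x k.L h]
  obtain ⟨y, hy, hxy⟩ := hp.exists_mem_Ico₀ k.Lpos s
  simp only [Prod.mk.injEq] at hxy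
  have hyy : k.f (y + h) = k.f y := by rw [← hxy.1, ← hxy.2, heq]
  rcases lt_or_ge (y + h) k.L with hlt | hge
  · have := k.inj ⟨by linarith [hy.1], hlt⟩ hy hyy
    linarith
  · have h2 : k.f (y + h - k.L) = k.f y := by
      rw [← hyy, ← k.per (y + h - k.L), sub_add_cancel]
    have := k.inj ⟨by linarith, by linarith [hy.2]⟩ hy h2
    linarith

theorem exists_min_chord {δ : ℝ} (hδ : δ ≤ k.L - δ) :
    ∃ s₀, ∃ h₀ ∈ Icc δ (k.L - δ), ∀ s, ∀ h ∈ Icc δ (k.L - δ),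
      ‖k.f (s₀ + h₀) - k.f s₀‖ ≤ ‖k.f (s + h) - k.f s‖ := by
  have hc : Continuous fun z : ℝ × ℝ => ‖k.f (z.1 + z.2) - k.f z.1‖ := by
    have := k.continuous_f
    fun_prop
  have hne : (Icc 0 k.L ×ˢ Icc δ (k.L - δ)).Nonempty :=
    ⟨(0, δ), ⟨⟨le_rfl, k.Lpos.le⟩, ⟨le_rfl, hδ⟩⟩⟩
  obtain ⟨z, hz, hmin⟩ := (isCompact_Icc.prod isCompact_Icc).exists_isMinOn hne hc.continuousOn
  rw [isMinOn_iff] at hmin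
  refine ⟨z.1, z.2, hz.2, fun s h hh => ?_⟩
  have hp : Function.Periodic (fun x => ‖k.f (x + h) - k.f x‖) k.L := fun x => by
    simp only [k.per, add_right_comm x k.L h]
  obtain ⟨y, hy, hxy⟩ := hp.exists_mem_Ico₀ k.Lpos s
  rw [hxy]
  exact hmin (y, h) ⟨⟨hy.1, hy.2.le⟩, hh⟩

theorem exists_pos_le_chord {δ : ℝ} (hδ : 0 < δ) :
    ∃ m > 0, ∀ s, ∀ h ∈ Icc δ (k.L - δ), m ≤ ‖k.f (s + h) - k.f s‖ := by
  by_cases hL : δ ≤ k.L - δ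
  · obtain ⟨s₀, h₀, hh, hmin⟩ := k.exists_min_chord hL
    refine ⟨_, norm_pos_iff.2 (sub_ne_zero.2 (k.f_add_ne ?_ ?_)), hmin⟩
    · linarith [hh.1]
    · linarith [hh.2]
  · exact ⟨1, one_pos, fun s h hh => absurd (hh.1.trans hh.2) hL⟩

/-- A property of parameter pairs only depending on the points of the knot may be checked on pairs
which are close, or whose difference is bounded away from the periods. -/
theorem pair_induction {P : ℝ → ℝ → Prop} {δ : ℝ} (hper : ∀ s t, P s t → P s (t + k.L))
    (hnear : ∀ s t, |t - s| ≤ δ → P s t)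
    (hfar : ∀ s, ∀ h ∈ Icc δ (k.L - δ), P s (s + h))
    (hper' : ∀ s t, P s (t + k.L) → P s t) (s t : ℝ) : P s t := by
  have hp : Function.Periodic (fun x => P s x) k.L := fun x =>
    propext ⟨hper' s x, hper s x⟩
  obtain ⟨y, hy, hxy⟩ := hp.exists_mem_Ico k.Lpos t s
  rw [hxy]
  rcases le_or_gt (y - s) δ with h1 | h1
  · exact hnear s y (by rwa [abs_of_nonneg (by linarith [hy.1])])
  rcases le_or_gt (y - s) (k.L - δ) with h2 | h2
  · simpa using hfar s (y - s) ⟨h1.le, h2⟩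
  · have := hper s (y - k.L) (hnear s (y - k.L) (by
      rw [abs_of_nonpos (by linarith [hy.2])]; linarith))
    simpa using this

theorem exists_isThick : ∃ ρ > 0, IsThick ρ k.f k.fd := by
  obtain ⟨M, hM0, hM⟩ := k.exists_lipschitz
  obtain ⟨m, hm0, hm⟩ := k.exists_pos_le_chord (δ := 1 / (2 * M)) (by positivity)
  refine ⟨min (1 / (8 * M)) (m / 2), by positivity, ?_⟩
  refine k.pair_induction (δ := 1 / (2 * M)) (fun s t h => ?_) (fun s t hst => ?_)
    (fun s h hh => ?_) (fun s t h => ?_)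
  · simpa only [k.per] using h
  · have hst' : M * |t - s| ≤ 1 / 2 := by
      rw [le_div_iff₀ (by positivity)] at hst
      linarith
    have h1 := half_abs_sub_le_norm_sub k.deriv k.unit hM hst'
    have h2 := (norm_normalPart_le (k.unit s) (k.f t - k.f s) (t - s)).trans
      (norm_taylor_le k.deriv hM s t)
    have h3 : (|t - s| / 2) ^ 2 ≤ ‖k.f t - k.f s‖ ^ 2 := pow_le_pow_left₀ (by positivity) h1 2
    calc _ ≤ 2 * (1 / (8 * M)) * (M * |t - s| ^ 2) := by
          gcongr
          exact min_le_left _ _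
      _ = (|t - s| / 2) ^ 2 := by field_simp; norm_num
      _ ≤ _ := h3
  · have h1 := hm s h hh
    have h2 := norm_normalPart_le (k.unit s) (k.f (s + h) - k.f s) 0
    rw [zero_smul, sub_zero] at h2
    calc _ ≤ 2 * (m / 2) * ‖k.f (s + h) - k.f s‖ := by
          gcongr
          exact min_le_right _ _
      _ ≤ _ := by nlinarith
  · simpa only [k.per] using h

variable {k}

theorem norm_fd_sub_le_of_isThick (h : IsThick ρ k.f k.fd) (hρ : 0 < ρ) (s t : ℝ) :
    ‖k.fd t - k.fd s‖ ≤ ρ⁻¹ * |t - s| := by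
  obtain ⟨M, -, hM⟩ := k.exists_lipschitz
  exact h.norm_tangent_sub_le hρ k.deriv k.unit hM s t

theorem le_length_of_isThick (h : IsThick ρ k.f k.fd) : ρ ≤ k.L := by
  by_contra! hlt
  have hρ : 0 < ρ := k.Lpos.trans hlt
  have hder : ∀ u, HasDerivAt (fun u => ⟪k.f u, k.fd 0⟫) ⟪k.fd u, k.fd 0⟫ u := fun u => by
    simpa using (k.deriv u).inner ℝ (hasDerivAt_const u (k.fd 0))
  obtain ⟨c, hc, hc0⟩ := exists_hasDerivAt_eq_zero k.Lpos
    (fun u _ => (hder u).continuousAt.continuousWithinAt)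
    (by simpa using congrArg (fun x => ⟪x, k.fd 0⟫) (k.per 0).symm) (fun u _ => hder u)
  have h1 := one_sub_inner_eq (k.unit c) (k.unit 0)
  have h2 := norm_fd_sub_le_of_isThick h hρ 0 c
  rw [sub_zero, abs_of_pos hc.1] at h2
  have h3 : ρ⁻¹ * c ≤ 1 := by
    rw [inv_mul_le_iff₀ hρ]; linarith [hc.2]
  rw [hc0] at h1
  nlinarith [norm_nonneg (k.fd c - k.fd 0)]

theorem le_RO_of_isThick (h : IsThick ρ k.f k.fd) : ρ ≤ RO k.f k.fd univ := by
  refine le_csInf ?_ ?_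
  · by_contra hempty
    rw [not_nonempty_iff_eq_empty] at hempty
    have hpos : 0 < k.L + 1 := by linarith [k.Lpos]
    have hthick : IsThick (k.L + 1) k.f k.fd := by
      intro s t
      by_contra! hlt
      set d := k.f t - k.f s with hd
      have hp : d - ⟪d, k.fd s⟫ • k.fd s ≠ 0 := by
        intro h0
        rw [h0, norm_zero, mul_zero] at hlt
        exact absurd hlt (not_lt.2 (sq_nonneg _))
      obtain ⟨w, hw, hwv, hdw⟩ := exists_unit_inner_eq_norm_normalPart (k.unit s) hp
      have : k.L + 1 ∈ (∅ : Set ℝ) := by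
        rw [← hempty]
        refine ⟨hpos, s, mem_univ _, t, mem_univ _, w, hw, hwv, ?_⟩
        rw [← hd, norm_sub_smul_lt_iff hpos hw, hdw]
        exact hlt
      exact this
    linarith [le_length_of_isThick hthick]
  · rintro r ⟨hr, s, -, t, -, w, hw, hwv, hlt⟩
    rw [norm_sub_smul_lt_iff hr hw] at hlt
    by_contra! hrρ
    have h1 := inner_le_norm_normalPart (d := k.f t - k.f s) hw hwv
    have h2 := h s t
    have h3 := norm_nonneg (k.f t - k.f s - ⟪k.f t - k.f s, k.fd s⟫ • k.fd s)
    nlinarith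

variable (k)

theorem RO_pos : 0 < RO k.f k.fd univ := by
  obtain ⟨ρ, hρ, h⟩ := k.exists_isThick
  exact hρ.trans_le (le_RO_of_isThick h)

theorem RO_le_length : RO k.f k.fd univ ≤ k.L :=
  le_length_of_isThick (isThick_RO k.unit)

variable {k}

theorem half_abs_sub_le_of_isThick (h : IsThick ρ k.f k.fd) (hρ : 0 < ρ) {s t : ℝ}
    (hst : |t - s| ≤ ρ / 2) : |t - s| / 2 ≤ ‖k.f t - k.f s‖ := by
  refine half_abs_sub_le_norm_sub k.deriv k.unit (norm_fd_sub_le_of_isThick h hρ) ?_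
  rw [inv_mul_le_iff₀ hρ]
  linarith

/-- Long arcs of a thick knot have long chords: the shortest such chord is critical at an end, and
thickness bounds critical chords from below. -/
theorem le_chord_of_isThick (h : IsThick ρ k.f k.fd) (hρ : 0 < ρ) (s : ℝ) {a : ℝ}
    (ha : a ∈ Icc (ρ / 2) (k.L - ρ / 2)) : ρ / 4 ≤ ‖k.f (s + a) - k.f s‖ := by
  obtain ⟨s₀, h₀, hh, hmin⟩ := k.exists_min_chord (ha.1.trans ha.2)
  refine le_trans ?_ (hmin s a ha)
  rcases eq_or_lt_of_le hh.1 with h1 | h1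
  · have := half_abs_sub_le_of_isThick h hρ (s := s₀) (t := s₀ + h₀)
      (by rw [add_sub_cancel_left, ← h1, abs_of_pos (by positivity)])
    rw [add_sub_cancel_left, abs_of_pos (by linarith)] at this
    linarith
  rcases eq_or_lt_of_le hh.2 with h2 | h2
  · have := half_abs_sub_le_of_isThick h hρ (s := s₀) (t := s₀ - ρ / 2)
      (by rw [sub_sub_cancel_left, abs_neg, abs_of_pos (by positivity)])
    rw [sub_sub_cancel_left, abs_neg, abs_of_pos (by positivity), ← k.per (s₀ - ρ / 2)] at this
    rw [h2, show s₀ + (k.L - ρ / 2) = s₀ - ρ / 2 + k.L by ring]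
    linarith
  · have hder : HasDerivAt (fun x => ‖k.f (s₀ + x) - k.f s₀‖ ^ 2)
        (2 * ⟪k.f (s₀ + h₀) - k.f s₀, k.fd (s₀ + h₀)⟫) h₀ :=
      (((k.deriv (s₀ + h₀)).comp_const_add s₀ h₀).sub_const (k.f s₀)).norm_sq
    have hloc : IsLocalMin (fun x => ‖k.f (s₀ + x) - k.f s₀‖ ^ 2) h₀ := by
      filter_upwards [Icc_mem_nhds h1 h2] with x hx
      exact pow_le_pow_left₀ (norm_nonneg _) (hmin s₀ x hx) 2
    have hcrit := hloc.hasDerivAt_eq_zero hder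
    have hperp : ⟪k.f s₀ - k.f (s₀ + h₀), k.fd (s₀ + h₀)⟫ = 0 := by
      rw [← neg_sub, inner_neg_left]; linarith
    have hth := h (s₀ + h₀) s₀
    rw [hperp, zero_smul, sub_zero, norm_sub_rev] at hth
    have hpos : 0 < ‖k.f (s₀ + h₀) - k.f s₀‖ :=
      norm_pos_iff.2 (sub_ne_zero.2 (k.f_add_ne (by linarith) (by linarith)))
    nlinarith

end Knot

theorem IsThick.mono {n : ℕ} {f fd : ℝ → Euc n} {ρ ρ' : ℝ} (h : IsThick ρ f fd) (hρ : ρ' ≤ ρ) :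
    IsThick ρ' f fd := fun s t =>
  (mul_le_mul_of_nonneg_right (by linarith) (norm_nonneg _)).trans (h s t)

namespace SameKnotClass

variable {n : ℕ}

theorem refl (k : Knot n) : SameKnotClass k k := by
  refine ⟨fun _ s => k.f (k.L * s), ?_, fun _ s => ?_, fun _ => rfl, fun _ => rfl,
    fun _ _ s hs t ht hst => ?_⟩
  · have := k.continuous_f
    exact Continuous.continuousOn (by fun_prop)
  · simp only [mul_add, mul_one, k.per]
  · have hmem : ∀ x ∈ Ico (0 : ℝ) 1, k.L * x ∈ Ico 0 k.L := fun x hx =>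
      ⟨mul_nonneg k.Lpos.le hx.1, by nlinarith [k.Lpos, hx.2]⟩
    exact mul_left_cancel₀ k.Lpos.ne' (k.inj (hmem s hs) (hmem t ht) hst)

theorem trans {k₁ k₂ k₃ : Knot n} (h₁ : SameKnotClass k₁ k₂) (h₂ : SameKnotClass k₂ k₃) :
    SameKnotClass k₁ k₃ := by
  obtain ⟨F, Fc, Fp, F0, F1, Fi⟩ := h₁
  obtain ⟨G, Gc, Gp, G0, G1, Gi⟩ := h₂
  have hF : Continuous fun z : ℝ × ℝ => F (projIcc 0 1 zero_le_one (2 * z.1)) z.2 :=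
    Fc.comp_continuous
      (f := fun z : ℝ × ℝ => ((projIcc (0 : ℝ) 1 zero_le_one (2 * z.1) : ℝ), z.2))
      (by have := continuous_projIcc (a := (0 : ℝ)) (b := 1) (h := zero_le_one); fun_prop)
      fun z => ⟨Subtype.coe_prop _, mem_univ _⟩
  have hG : Continuous fun z : ℝ × ℝ => G (projIcc 0 1 zero_le_one (2 * z.1 - 1)) z.2 :=
    Gc.comp_continuous
      (f := fun z : ℝ × ℝ => ((projIcc (0 : ℝ) 1 zero_le_one (2 * z.1 - 1) : ℝ), z.2))
      (by have := continuous_projIcc (a := (0 : ℝ)) (b := 1) (h := zero_le_one); fun_prop)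
      fun z => ⟨Subtype.coe_prop _, mem_univ _⟩
  refine ⟨fun τ s => if τ ≤ 1 / 2 then F (projIcc 0 1 zero_le_one (2 * τ)) s
    else G (projIcc 0 1 zero_le_one (2 * τ - 1)) s, ?_, fun τ s => ?_, fun s => ?_, fun s => ?_,
    fun τ _ => ?_⟩
  · refine Continuous.continuousOn (hF.if_le hG continuous_fst continuous_const fun z hz => ?_)
    rw [hz]
    norm_num [F1, G0]
  · simp only [Fp, Gp]
  · norm_num [F0]
  · norm_num [G1]
  · by_cases hτ : τ ≤ 1 / 2
    · simp only [hτ, if_true]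
      exact Fi _ (Subtype.coe_prop _)
    · simp only [hτ, if_false]
      exact Gi _ (Subtype.coe_prop _)

end SameKnotClass

namespace Knot

variable {n : ℕ}

/-- The knot rescaled to unit length and translated so as to start at the origin. -/
noncomputable def normalize (k : Knot n) : Knot n where
  L := 1
  Lpos := one_pos
  f s := k.L⁻¹ • (k.f (k.L * s) - k.f 0)
  fd s := k.fd (k.L * s)
  per s := by simp only [mul_add, mul_one, k.per]
  perd s := by simp only [mul_add, mul_one, k.perd]
  deriv s := by
    have h1 : HasDerivAt (fun x => k.f (k.L * x)) (k.L • k.fd (k.L * s)) s :=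
      (k.deriv (k.L * s)).scomp s (by simpa using (hasDerivAt_id s).const_mul k.L)
    have h2 := (h1.sub_const (k.f 0)).const_smul k.L⁻¹
    rwa [smul_smul, inv_mul_cancel₀ k.Lpos.ne', one_smul] at h2
  unit s := k.unit _
  lipd := by
    obtain ⟨C, hC⟩ := k.lipd
    refine ⟨C * ⟨k.L, k.Lpos.le⟩, LipschitzWith.of_dist_le_mul fun x y => ?_⟩
    refine (hC.dist_le_mul _ _).trans (le_of_eq ?_)
    rw [Real.dist_eq, Real.dist_eq, ← mul_sub, abs_mul, abs_of_pos k.Lpos, ← mul_assoc]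
    rfl
  inj s hs t ht hst := by
    have hmem : ∀ x ∈ Ico (0 : ℝ) 1, k.L * x ∈ Ico 0 k.L := fun x hx =>
      ⟨mul_nonneg k.Lpos.le hx.1, by nlinarith [k.Lpos, hx.2]⟩
    have h1 := smul_right_injective (Euc n) (inv_ne_zero k.Lpos.ne') hst
    exact mul_left_cancel₀ k.Lpos.ne' (k.inj (hmem s hs) (hmem t ht) (sub_left_injective h1))

theorem normalize_L (k : Knot n) : k.normalize.L = 1 := rfl

theorem normalize_f_zero (k : Knot n) : k.normalize.f 0 = 0 := by
  simp [normalize]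

theorem isThick_normalize {k : Knot n} {ρ : ℝ} (h : IsThick ρ k.f k.fd) :
    IsThick (ρ / k.L) k.normalize.f k.normalize.fd := by
  intro s t
  have hL := k.Lpos
  have h1 : k.normalize.f t - k.normalize.f s = k.L⁻¹ • (k.f (k.L * t) - k.f (k.L * s)) := by
    simp only [normalize, ← smul_sub, sub_sub_sub_cancel_right]
  have h2 := h (k.L * s) (k.L * t)
  rw [h1]
  set d := k.f (k.L * t) - k.f (k.L * s)
  have h3 : k.L⁻¹ • d - ⟪k.L⁻¹ • d, k.normalize.fd s⟫ • k.normalize.fd s =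
      k.L⁻¹ • (d - ⟪d, k.fd (k.L * s)⟫ • k.fd (k.L * s)) := by
    rw [real_inner_smul_left, mul_smul, ← smul_sub]
    rfl
  rw [h3, norm_smul, norm_smul, norm_inv, Real.norm_of_nonneg hL.le]
  calc _ = (k.L⁻¹) ^ 2 * (2 * ρ * ‖d - ⟪d, k.fd (k.L * s)⟫ • k.fd (k.L * s)‖) := by
        field_simp
    _ ≤ (k.L⁻¹) ^ 2 * ‖d‖ ^ 2 := by gcongr
    _ = _ := by ring

theorem sameKnotClass_normalize (k : Knot n) : SameKnotClass k k.normalize := by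
  refine ⟨fun τ s => ((1 - τ) + τ * k.L⁻¹) • (k.f (k.L * s) - τ • k.f 0), ?_, fun τ s => ?_,
    fun s => ?_, fun s => ?_, fun τ hτ s hs t ht hst => ?_⟩
  · have := k.continuous_f
    exact Continuous.continuousOn (by fun_prop)
  · simp only [mul_add, mul_one, k.per]
  · simp
  · simp [normalize]
  · have hmem : ∀ x ∈ Ico (0 : ℝ) 1, k.L * x ∈ Ico 0 k.L := fun x hx =>
      ⟨mul_nonneg k.Lpos.le hx.1, by nlinarith [k.Lpos, hx.2]⟩
    have hpos : 0 < (1 - τ) + τ * k.L⁻¹ := by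
      have hinv : 0 < k.L⁻¹ := inv_pos.2 k.Lpos
      rcases eq_or_lt_of_le hτ.1 with h0 | h0
      · rw [← h0]; norm_num
      · have := mul_pos h0 hinv
        linarith [hτ.2]
    have h1 := smul_right_injective (Euc n) hpos.ne' hst
    exact mul_left_cancel₀ k.Lpos.ne' (k.inj (hmem s hs) (hmem t ht) (sub_left_injective h1))

/-- Uniformly thick knots of unit length which are `C¹`-close are in the same knot class, by linear
interpolation. -/
theorem sameKnotClass_of_close {a b : Knot n} {ρ : ℝ} (hρ : 0 < ρ) (haL : a.L = 1) (hbL : b.L = 1)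
    (ha : IsThick ρ a.f a.fd) (hb : IsThick ρ b.f b.fd)
    (hf : ∀ s, ‖a.f s - b.f s‖ ≤ ρ / 16) (hfd : ∀ s, ‖a.fd s - b.fd s‖ ≤ 1 / 4) :
    SameKnotClass a b := by
  refine ⟨fun τ s => (1 - τ) • a.f s + τ • b.f s, ?_, fun τ s => ?_, fun s => ?_, fun s => ?_,
    fun τ hτ s hs t ht hst => ?_⟩
  · have h1 := a.continuous_f
    have h2 := b.continuous_f
    exact Continuous.continuousOn (by fun_prop)
  · have h1 := a.per s
    have h2 := b.per s
    rw [haL] at h1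
    rw [hbL] at h2
    simp only [h1, h2]
  · simp [haL]
  · simp [hbL]
  have hτ0 : 0 ≤ τ := hτ.1
  have hτ1 : 0 ≤ 1 - τ := sub_nonneg.2 hτ.2
  set h : ℝ → Euc n := fun s => (1 - τ) • a.f s + τ • b.f s with hh
  set hd : ℝ → Euc n := fun s => (1 - τ) • a.fd s + τ • b.fd s with hhd
  have hder : ∀ s, HasDerivAt h (hd s) s := fun s =>
    ((a.deriv s).const_smul (1 - τ)).add ((b.deriv s).const_smul τ)
  have hconv : ∀ x y : Euc n, ‖(1 - τ) • x + τ • y‖ ≤ (1 - τ) * ‖x‖ + τ * ‖y‖ := fun x y => by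
    refine (norm_add_le _ _).trans_eq ?_
    rw [norm_smul, norm_smul, Real.norm_of_nonneg hτ0, Real.norm_of_nonneg hτ1]
  have hlip : ∀ s t, ‖hd t - hd s‖ ≤ ρ⁻¹ * |t - s| := fun s t => by
    have h1 := norm_fd_sub_le_of_isThick ha hρ s t
    have h2 := norm_fd_sub_le_of_isThick hb hρ s t
    have h3 : hd t - hd s = (1 - τ) • (a.fd t - a.fd s) + τ • (b.fd t - b.fd s) := by
      simp only [hhd]; module
    rw [h3]
    refine (hconv _ _).trans ?_
    nlinarith
  have hτ2 : τ ≤ 1 := hτ.2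
  have hspeed : ∀ s, 3 / 4 ≤ ‖hd s‖ := fun s => by
    have h1 : hd s = a.fd s - τ • (a.fd s - b.fd s) := by simp only [hhd]; module
    have h2 := norm_sub_norm_le (a.fd s) (τ • (a.fd s - b.fd s))
    rw [norm_smul, Real.norm_of_nonneg hτ0, a.unit] at h2
    have h3 := hfd s
    rw [h1]
    nlinarith [norm_nonneg (a.fd s - b.fd s)]
  have hclose : ∀ s, ‖a.f s - h s‖ ≤ ρ / 16 := fun s => by
    have h1 : a.f s - h s = τ • (a.f s - b.f s) := by simp only [hh]; module
    rw [h1, norm_smul, Real.norm_of_nonneg hτ0]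
    nlinarith [hf s, norm_nonneg (a.f s - b.f s)]
  have hper : ∀ s, h (s + a.L) = h s := fun s => by
    have h2 := b.per s
    rw [hbL, ← haL] at h2
    simp only [hh, a.per, h2]
  have key : ∀ s t, h s = h t → ∃ m : ℤ, t = s + m := by
    refine a.pair_induction (δ := ρ / 2) (fun s t hP heq => ?_) (fun s t hst heq => ?_)
      (fun s c hc heq => ?_) (fun s t hP heq => ?_)
    · obtain ⟨m, hm⟩ := hP (by rw [heq, hper])
      exact ⟨m + 1, by rw [hm, haL]; push_cast; ring⟩
    · have h1 := norm_taylor_le hder hlip s t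
      rw [heq, sub_self, zero_sub, norm_neg, norm_smul, Real.norm_eq_abs] at h1
      have h2 : ρ⁻¹ * |t - s| ≤ 1 / 2 := by
        rw [inv_mul_le_iff₀ hρ]; linarith
      have h3 := hspeed s
      have h4 : |t - s| ≤ 0 := by nlinarith [abs_nonneg (t - s)]
      have h5 := abs_nonpos_iff.1 h4
      exact ⟨0, by push_cast; linarith⟩
    · exfalso
      have h1 := le_chord_of_isThick ha hρ s hc
      have h2 : a.f (s + c) - a.f s = (a.f (s + c) - h (s + c)) - (a.f s - h s) := by
        rw [heq]; abel
      have h3 := norm_sub_le (a.f (s + c) - h (s + c)) (a.f s - h s)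
      rw [← h2] at h3
      linarith [hclose s, hclose (s + c)]
    · obtain ⟨m, hm⟩ := hP (by rw [heq, hper])
      exact ⟨m - 1, by rw [haL] at hm; push_cast; linarith⟩
  obtain ⟨m, hm⟩ := key s t hst
  have hm1 : (m : ℝ) < 1 := by linarith [hs.1, ht.2]
  have hm2 : (-1 : ℝ) < m := by linarith [hs.2, ht.1]
  have hm0 : m = 0 := by
    have h1 : m < 1 := by exact_mod_cast hm1
    have h2 : -1 < m := by exact_mod_cast hm2
    omega
  rw [hm, hm0, Int.cast_zero, add_zero]

end Knot

section Limits

variable {n : ℕ}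

theorem exists_tendsto_of_norm_le {ι : Type*} (l : Ultrafilter ι) {u : ι → Euc n} {C : ℝ}
    (h : ∀ i, ‖u i‖ ≤ C) : ∃ a, Tendsto u l (𝓝 a) := by
  obtain ⟨a, -, ha⟩ := (isCompact_closedBall (0 : Euc n) C).ultrafilter_le_nhds (l.map u) (by
    refine tendsto_principal.2 (Eventually.of_forall fun i => ?_)
    simpa using h i)
  exact ⟨a, ha⟩

theorem eventually_norm_sub_le_of_lipschitz {ι : Type*} {l : Filter ι} [l.NeBot]
    {u : ι → ℝ → Euc n} {v : ℝ → Euc n} {M ε : ℝ} (hM0 : 0 < M)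
    (hM : ∀ i s t, ‖u i t - u i s‖ ≤ M * |t - s|) (hper : ∀ i s, u i (s + 1) = u i s)
    (hlim : ∀ s, Tendsto (fun i => u i s) l (𝓝 (v s))) (hε : 0 < ε) :
    ∀ᶠ i in l, ∀ s, ‖u i s - v s‖ ≤ ε := by
  have hvM : ∀ s t, ‖v t - v s‖ ≤ M * |t - s| := fun s t =>
    le_of_tendsto' ((hlim t).sub (hlim s)).norm fun i => hM i s t
  have hvper : ∀ s, v (s + 1) = v s := fun s =>
    tendsto_nhds_unique ((hlim (s + 1)).congr fun i => hper i s) (hlim s)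
  obtain ⟨T, -, hTfin, hTcov⟩ := (isCompact_Icc (a := (0 : ℝ)) (b := 1)).finite_cover_balls
    (e := ε / (4 * M)) (by positivity)
  have hev : ∀ᶠ i in l, ∀ x ∈ T, ‖u i x - v x‖ < ε / 2 :=
    (eventually_all_finite hTfin).2 fun x _ => by
      have h1 := ((hlim x).sub_const (v x)).norm
      rw [sub_self, norm_zero] at h1
      exact h1.eventually_lt_const (by positivity)
  filter_upwards [hev] with i hi s
  have hp : Function.Periodic (fun x => ‖u i x - v x‖) 1 := fun x => by
    simp only [hper, hvper]
  obtain ⟨y, hy, hsy⟩ := hp.exists_mem_Ico₀ one_pos s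
  rw [hsy]
  obtain ⟨x, hx, hyx⟩ := mem_iUnion₂.1 (hTcov ⟨hy.1, hy.2.le⟩)
  rw [Metric.mem_ball, Real.dist_eq, lt_div_iff₀ (by positivity)] at hyx
  have h1 := hM i x y
  have h2 := hvM y x
  rw [abs_sub_comm] at h2
  have h3 := hi x hx
  have h4 : u i y - v y = (u i y - u i x) + (u i x - v x) + (v x - v y) := by abel
  rw [h4]
  refine (norm_add₃_le).trans ?_
  linarith

/-- Thick knots of unit length form a compact family, and knot classes are closed in it. -/
theorem Knot.exists_limit {g : ℕ → Knot n} {x : ℕ → ℝ} {c R : ℝ} (hc : 0 < c)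
    (hgL : ∀ i, (g i).L = 1) (hg0 : ∀ i, (g i).f 0 = 0)
    (hg : ∀ i, IsThick (x i) (g i).f (g i).fd) (hx : ∀ i, c ≤ x i)
    (hxR : Tendsto x atTop (𝓝 R)) :
    ∃ k : Knot n, k.L = 1 ∧ IsThick R k.f k.fd ∧ ∃ i, SameKnotClass (g i) k := by
  set l : Ultrafilter ℕ := hyperfilter ℕ
  have hl : Tendsto x l (𝓝 R) := hxR.mono_left Nat.hyperfilter_le_atTop
  have hcR : c ≤ R := ge_of_tendsto' hl hx
  have hgc : ∀ i, IsThick c (g i).f (g i).fd := fun i => (hg i).mono (hx i)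
  have hbd : ∀ s i, ‖(g i).f s‖ ≤ |s| := fun s i => by
    simpa [hg0] using norm_sub_le_abs_sub (g i).deriv (g i).unit 0 s
  choose f hf using fun s => exists_tendsto_of_norm_le l (hbd s)
  choose fd hfd using fun s => exists_tendsto_of_norm_le l (fun i => ((g i).unit s).le)
  have hlip : ∀ i s t, ‖(g i).fd t - (g i).fd s‖ ≤ c⁻¹ * |t - s| := fun i =>
    norm_fd_sub_le_of_isThick (hgc i) hc
  have hper : ∀ i s, (g i).f (s + 1) = (g i).f s := fun i s => by
    rw [← hgL i, (g i).per]
  have hperd : ∀ i s, (g i).fd (s + 1) = (g i).fd s := fun i s => by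
    rw [← hgL i, (g i).perd]
  have hthick : IsThick R f fd := fun s t => by
    have hd := (hf t).sub (hf s)
    exact le_of_tendsto_of_tendsto'
      ((hl.const_mul 2).mul (hd.sub ((hd.inner (hfd s)).smul (hfd s))).norm) (hd.norm.pow 2)
      fun i => hg i s t
  have hinj : ∀ s, ∀ h ∈ Icc (c / 2) (1 - c / 2), c / 4 ≤ ‖f (s + h) - f s‖ := fun s h hh =>
    ge_of_tendsto' ((hf (s + h)).sub (hf s)).norm fun i =>
      le_chord_of_isThick (hgc i) hc s (by rwa [hgL])
  have hnear : ∀ s t, |t - s| ≤ c / 2 → |t - s| / 2 ≤ ‖f t - f s‖ := fun s t hst =>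
    ge_of_tendsto' ((hf t).sub (hf s)).norm fun i =>
      half_abs_sub_le_of_isThick (hgc i) hc hst
  have hfper : ∀ s, f (s + 1) = f s := fun s =>
    tendsto_nhds_unique ((hf (s + 1)).congr fun i => hper i s) (hf s)
  have hlt : ∀ s t, s ∈ Ico (0 : ℝ) 1 → t ∈ Ico (0 : ℝ) 1 → s < t → f s ≠ f t := by
    intro s t hs ht hst heq
    rcases le_or_gt (t - s) (c / 2) with h1 | h1
    · have h2 := hnear s t (by rwa [abs_of_pos (by linarith)])
      rw [heq, sub_self, norm_zero, abs_of_pos (by linarith)] at h2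
      linarith
    rcases le_or_gt (t - s) (1 - c / 2) with h2 | h2
    · have h3 := hinj s (t - s) ⟨h1.le, h2⟩
      rw [add_sub_cancel, heq, sub_self, norm_zero] at h3
      linarith
    · have h4 : |t - 1 - s| = 1 - t + s := by
        rw [abs_of_neg (by linarith [hs.1, ht.2])]; ring
      have h3 := hnear s (t - 1) (by rw [h4]; linarith)
      rw [← hfper (t - 1), sub_add_cancel, heq, sub_self, norm_zero, h4] at h3
      linarith [hs.1, ht.2]
  let k : Knot n :=
    { L := 1
      Lpos := one_pos
      f := f
      fd := fd
      per := hfper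
      perd := fun s => tendsto_nhds_unique ((hfd (s + 1)).congr fun i => hperd i s) (hfd s)
      deriv := hasDerivAt_of_norm_taylor_le (M := c⁻¹) fun s t =>
        le_of_tendsto' (((hf t).sub (hf s)).sub ((hfd s).const_smul (t - s))).norm fun i =>
          norm_taylor_le (g i).deriv (hlip i) s t
      unit := fun s => tendsto_nhds_unique ((hfd s).norm.congr fun i => (g i).unit s)
        tendsto_const_nhds
      lipd := ⟨⟨c⁻¹, by positivity⟩, LipschitzWith.of_dist_le_mul fun s t => by
        rw [dist_eq_norm, Real.dist_eq]
        exact le_of_tendsto' ((hfd s).sub (hfd t)).norm fun i => hlip i t s⟩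
      inj := fun s hs t ht hst => by
        rcases lt_trichotomy s t with h | h | h
        · exact absurd hst (hlt s t hs ht h)
        · exact h
        · exact absurd hst.symm (hlt t s ht hs h) }
  have e1 := eventually_norm_sub_le_of_lipschitz (l := (l : Filter ℕ)) (M := 1)
    (u := fun i => (g i).f) one_pos
    (fun i s t => by simpa using norm_sub_le_abs_sub (g i).deriv (g i).unit s t) hper hf
    (show 0 < c / 16 by positivity)
  have e2 := eventually_norm_sub_le_of_lipschitz (l := (l : Filter ℕ)) (u := fun i => (g i).fd)
    (inv_pos.2 hc) hlip hperd hfd (show (0 : ℝ) < 1 / 4 by norm_num)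
  obtain ⟨i, h1, h2⟩ := (e1.and e2).exists
  exact ⟨k, rfl, hthick, i, sameKnotClass_of_close hc (hgL i) rfl (hgc i) (hthick.mono hcR) h1 h2⟩

end Limits

/-- Existence of ideal knots. Every knot class contains a `C^{1,1}` knot
`γ₀` with `R_O(K₀) > 0` minimizing the ropelength: `ℓ(γ₀)·R_O(K) ≤ ℓ(γ)·R_O(K₀)` for every
knot `γ` in the class; in particular `ℓ(γ₀) = ℓ(γ)` implies `R_O(K₀) ≥ R_O(K)`. -/
theorem statement_16 {n : ℕ} (hn : 2 ≤ n) (γ₁ : Knot n) :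
    ∃ γ₀ : Knot n, SameKnotClass γ₁ γ₀ ∧ 0 < RO γ₀.f γ₀.fd Set.univ ∧
      ∀ γ : Knot n, SameKnotClass γ₁ γ →
        (γ₀.L * RO γ.f γ.fd Set.univ ≤ γ.L * RO γ₀.f γ₀.fd Set.univ ∧
         (γ₀.L = γ.L → RO γ.f γ.fd Set.univ ≤ RO γ₀.f γ₀.fd Set.univ)) := by
  set A : Set ℝ := {x | ∃ γ : Knot n, SameKnotClass γ₁ γ ∧ x = RO γ.f γ.fd univ / γ.L}
  have hne : A.Nonempty := ⟨_, γ₁, SameKnotClass.refl γ₁, rfl⟩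
  have hbdd : BddAbove A := ⟨1, by
    rintro _ ⟨γ, -, rfl⟩
    exact (div_le_one γ.Lpos).2 γ.RO_le_length⟩
  set R := sSup A
  have hR : 0 < R := (div_pos γ₁.RO_pos γ₁.Lpos).trans_le
    (le_csSup hbdd ⟨γ₁, SameKnotClass.refl γ₁, rfl⟩)
  have hex : ∀ i : ℕ, ∃ γ : Knot n, SameKnotClass γ₁ γ ∧
      R - R / 2 * (1 / ((i : ℝ) + 1)) < RO γ.f γ.fd univ / γ.L := fun i => by
    obtain ⟨_, ⟨γ, hγ, rfl⟩, hlt⟩ := exists_lt_of_lt_csSup hne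
      (show R - R / 2 * (1 / ((i : ℝ) + 1)) < sSup A from sub_lt_self R (by positivity))
    exact ⟨γ, hγ, hlt⟩
  choose γ hγ hlt using hex
  have hxR : Tendsto (fun i : ℕ => R - R / 2 * (1 / ((i : ℝ) + 1))) atTop (𝓝 R) := by
    simpa using (tendsto_one_div_add_atTop_nhds_zero_nat.const_mul (R / 2)).const_sub R
  obtain ⟨γ₀, hL, hthick, i, hi⟩ := Knot.exists_limit (g := fun i => (γ i).normalize)
    (c := R / 2) (by positivity) (fun i => (γ i).normalize_L) (fun i => (γ i).normalize_f_zero)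
    (fun i => (Knot.isThick_normalize (isThick_RO (γ i).unit)).mono (hlt i).le)
    (fun i => by
      have h1 : 1 / ((i : ℝ) + 1) ≤ 1 := by
        rw [div_le_one (by positivity)]
        linarith [Nat.cast_nonneg (α := ℝ) i]
      nlinarith) hxR
  have key : ∀ γ : Knot n, SameKnotClass γ₁ γ →
      γ₀.L * RO γ.f γ.fd univ ≤ γ.L * RO γ₀.f γ₀.fd univ := fun γ hγ => by
    have h1 : RO γ.f γ.fd univ / γ.L ≤ R := le_csSup hbdd ⟨γ, hγ, rfl⟩
    have h2 := h1.trans (Knot.le_RO_of_isThick hthick)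
    rw [div_le_iff₀ γ.Lpos] at h2
    rw [hL]
    linarith
  refine ⟨γ₀, (hγ i).trans ((γ i).sameKnotClass_normalize.trans hi), γ₀.RO_pos,
    fun γ hγ => ⟨key γ hγ, fun hLL => ?_⟩⟩
  have := key γ hγ
  rw [hLL] at this
  exact le_of_mul_le_mul_left this γ.Lpos
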